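/- Zeros of flat-band eigenfunctions in the trivial representation: Let U be a tunnelling potential and consider the chiral model D(α). If u ∈ Ker₀(α), then u(z_S) = 0 and u(−z_S) = 0, where z_S := i/√3 (the stacking point, satisfying ω·z_S = z_S − (1+ω)); moreover there exist smooth functions w₁, w₂ : ℂ → ℂ² such that u(z) = (z − z_S)·w₁(z) and u(z) = (z + z_S)·w₂(z) for all z ∈ ℂ. -/

import Mathlib

noncomputable section

open Complex MeasureTheory

namespace TBG

/-- `ω = exp(2πi/3)`. -/
def ω : ℂ := Complex.exp (2 * Real.pi * Complex.I / 3)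

/-- The moiré lattice `Λ = ℤω + ℤ ⊂ ℂ`. -/
def Λ : Set ℂ := {z : ℂ | ∃ m n : ℤ, z = m * ω + n}

/-- The dual lattice `Λ* = (4πi/√3)·Λ`. -/
def Λdual : Set ℂ := {p : ℂ | ∃ m n : ℤ, p = 4 * Real.pi * Complex.I / Real.sqrt 3 * (m * ω + n)}

/-- The high symmetry point `K = 4π/3`. -/
def K : ℂ := 4 * Real.pi / 3

/-- `⟨z,w⟩ = Re (z · conj w)`. -/
def pair (z w : ℂ) : ℝ := (z * (starRingEnd ℂ) w).re

/-- `2 D_z̄ f = (1/i)(∂_x f + i ∂_y f)`. -/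
def Dbar (f : ℂ → ℂ) (z : ℂ) : ℂ :=
  1 / Complex.I * (fderiv ℝ f z 1 + Complex.I * fderiv ℝ f z Complex.I)

/-- A tunnelling potential: smooth, with the translational and rotational symmetries. -/
def IsTunnelling (U : ℂ → ℂ) : Prop :=
  ContDiff ℝ (⊤ : ℕ∞) U ∧
    (∀ γ ∈ Λ, ∀ z : ℂ, U (z + γ) = Complex.exp (Complex.I * (pair γ K : ℂ)) * U z) ∧
    ∀ z : ℂ, U (ω * z) = ω * U z

/-- Membership in `ker_{L²₀}(D(α)+k)` for the chiral model with tunnelling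
potentials `U₊ = Up`, `U₋ = Um`: smooth solutions of `(D(α)+k)u = 0` with the
Floquet boundary conditions. -/
def InKer (Up Um : ℂ → ℂ) (α k : ℂ) (u : ℂ → ℂ × ℂ) : Prop :=
  ContDiff ℝ (⊤ : ℕ∞) u ∧
    (∀ z : ℂ, Dbar (fun w => (u w).1) z + k * (u z).1 + α * Up z * (u z).2 = 0) ∧
    (∀ z : ℂ, Dbar (fun w => (u w).2) z + k * (u z).2 + α * Um z * (u z).1 = 0) ∧
    (∀ γ ∈ Λ, ∀ z : ℂ, (u (z + γ)).1 = Complex.exp (-Complex.I * (pair γ K : ℂ)) * (u z).1) ∧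
    (∀ γ ∈ Λ, ∀ z : ℂ, (u (z + γ)).2 = Complex.exp (Complex.I * (pair γ K : ℂ)) * (u z).2)

/-- `Ker(α,k)` as a set of functions. -/
def kerSet (Up Um : ℂ → ℂ) (α k : ℂ) : Set (ℂ → ℂ × ℂ) := {u | InKer Up Um α k u}

/-- `dim_ℂ Ker(α,k)` (the set `Ker(α,k)` is a linear subspace, so the finrank of its span
is its dimension). -/
def kerDim (Up Um : ℂ → ℂ) (α k : ℂ) : ℕ :=
  Module.finrank ℂ ↥(Submodule.span ℂ (kerSet Up Um α k))

/-- `Ker_p(α) = {u ∈ Ker(α,0) : u(ωz) = ω^(−p)·u(z)}`. -/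
def kerPSet (Up Um : ℂ → ℂ) (α : ℂ) (p : ℕ) : Set (ℂ → ℂ × ℂ) :=
  {u | u ∈ kerSet Up Um α 0 ∧ ∀ z : ℂ, u (ω * z) = (ω ^ (-(p : ℤ))) • u z}

/-- `dim_ℂ Ker_p(α)`. -/
def kerPDim (Up Um : ℂ → ℂ) (α : ℂ) (p : ℕ) : ℕ :=
  Module.finrank ℂ ↥(Submodule.span ℂ (kerPSet Up Um α p))

/-- `α` is magic: the flat band condition `Ker(α,k) ≠ {0}` for every `k`. -/
def IsMagic (Up Um : ℂ → ℂ) (α : ℂ) : Prop :=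
  ∀ k : ℂ, ∃ u ∈ kerSet Up Um α k, u ≠ 0


/-- The stacking point `z_S = i/√3`. -/
def zS : ℂ := Complex.I / Real.sqrt 3

section Hadamard

universe v

/-- An integral over a compact interval of a `C^n` function of the parameter and the
integration variable is `C^n` in the parameter. -/
theorem contDiff_nat_intervalIntegral {E : Type v} [NormedAddCommGroup E] [NormedSpace ℝ E]
    [ProperSpace E] (a b : ℝ) (n : ℕ) :
    ∀ {F : Type v} [NormedAddCommGroup F] [NormedSpace ℝ F] {f : E × ℝ → F},
      ContDiff ℝ n f → ContDiff ℝ n (fun x => ∫ t in a..b, f (x, t)) := by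
  induction n with
  | zero =>
    intro F _ _ f hf
    have hc : Continuous f := hf.continuous
    have := intervalIntegral.continuous_parametric_intervalIntegral_of_continuous'
      (μ := volume) (f := fun x t => f (x, t)) (by simpa [Function.uncurry_def] using hc) a b
    exact contDiff_zero.2 this
  | succ n ih =>
    intro F _ _ f hf
    have hf' : ContDiff ℝ ((n : WithTop ℕ∞) + 1) f := by exact_mod_cast hf
    have hf1 : ContDiff ℝ n (fderiv ℝ f) := hf'.fderiv_right le_rfl
    set L : E →L[ℝ] E × ℝ := ContinuousLinearMap.inl ℝ E ℝ
    set f' : E × ℝ → E →L[ℝ] F := fun p => (fderiv ℝ f p).comp L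
    have hf2 : ContDiff ℝ n f' := hf1.clm_comp contDiff_const
    have hfd : Differentiable ℝ f := hf'.differentiable (by simp)
    have hd : ∀ x, HasFDerivAt (fun x => ∫ t in a..b, f (x, t)) (∫ t in a..b, f' (x, t)) x := by
      intro x
      have hK : IsCompact (Metric.closedBall x 1 ×ˢ Set.uIcc a b) :=
        (isCompact_closedBall x 1).prod isCompact_uIcc
      obtain ⟨C, hC⟩ := hK.exists_bound_of_continuousOn hf2.continuous.continuousOn
      have hcx : ∀ x, Continuous fun t => f (x, t) := fun x => hf.continuous.comp (by fun_prop)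
      have hcx' : Continuous fun t => f' (x, t) := hf2.continuous.comp (by fun_prop)
      refine intervalIntegral.hasFDerivAt_integral_of_dominated_of_fderiv_le
        (F := fun x t => f (x, t)) (F' := fun x t => f' (x, t)) (bound := fun _ => C)
        (Metric.closedBall_mem_nhds x one_pos)
        (Filter.Eventually.of_forall fun y => (hcx y).aestronglyMeasurable)
        ((hcx x).intervalIntegrable _ _) hcx'.aestronglyMeasurable
        (Filter.Eventually.of_forall fun t ht y hy =>
          hC (y, t) ⟨hy, Set.uIoc_subset_uIcc ht⟩) (by simp)
        (Filter.Eventually.of_forall fun t _ y _ => ?_)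
      exact (hfd (y, t)).hasFDerivAt.comp y (hasFDerivAt_prodMk_left y t)
    have : ContDiff ℝ ((n : WithTop ℕ∞) + 1) (fun x => ∫ t in a..b, f (x, t)) := by
      refine contDiff_succ_iff_fderiv.2 ⟨fun x => (hd x).differentiableAt, by simp, ?_⟩
      rw [show fderiv ℝ (fun x => ∫ t in a..b, f (x, t)) = fun x => ∫ t in a..b, f' (x, t) from
        funext fun x => (hd x).fderiv]
      exact ih hf2
    exact_mod_cast this

/-- Hadamard's lemma: `f z - f 0 = G z z` with `G` smooth. -/
theorem exists_contDiff_clm_apply_eq_sub {E F : Type v} [NormedAddCommGroup E]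
    [NormedSpace ℝ E] [ProperSpace E] [NormedAddCommGroup F] [NormedSpace ℝ F] [CompleteSpace F]
    {f : E → F} (hf : ContDiff ℝ (⊤ : ℕ∞) f) :
    ∃ G : E → E →L[ℝ] F, ContDiff ℝ (⊤ : ℕ∞) G ∧ ∀ z, f z - f 0 = G z z := by
  have hf1 : ContDiff ℝ (⊤ : ℕ∞) (fderiv ℝ f) := hf.fderiv_right (by simp)
  have hsc : ContDiff ℝ (⊤ : ℕ∞) (fun p : E × ℝ => fderiv ℝ f (p.2 • p.1)) :=
    hf1.comp (contDiff_snd.smul contDiff_fst)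
  refine ⟨fun z => ∫ t in (0 : ℝ)..1, fderiv ℝ f (t • z), contDiff_infty.2 fun n => ?_,
    fun z => ?_⟩
  · exact contDiff_nat_intervalIntegral 0 1 n
      (f := fun p : E × ℝ => fderiv ℝ f (p.2 • p.1)) (contDiff_infty.1 hsc n)
  · have hc : Continuous fun t : ℝ => fderiv ℝ f (t • z) := hf1.continuous.comp (by fun_prop)
    rw [ContinuousLinearMap.intervalIntegral_apply (hc.intervalIntegrable _ _),
      intervalIntegral.integral_eq_sub_of_hasDerivAt (f := fun t : ℝ => f (t • z))]
    · simp
    · intro t _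
      have h1 : HasDerivAt (fun t : ℝ => t • z) z t := by
        simpa using (hasDerivAt_id t).smul_const z
      exact ((hf.differentiable (by simp)) (t • z)).hasFDerivAt.comp_hasDerivAt t h1
    · exact (hc.clm_apply continuous_const).intervalIntegrable _ _

end Hadamard

open scoped ComplexConjugate

/-- A smooth function on `ℂ` vanishing at `0` splits as `z * A z + conj z * B z`. -/
theorem exists_eq_mul_add_conj_mul {f : ℂ → ℂ} (hf : ContDiff ℝ (⊤ : ℕ∞) f) (h0 : f 0 = 0) :
    ∃ A B : ℂ → ℂ, ContDiff ℝ (⊤ : ℕ∞) A ∧ ContDiff ℝ (⊤ : ℕ∞) B ∧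
      ∀ z, f z = z * A z + conj z * B z := by
  obtain ⟨G, hG, h⟩ := exists_contDiff_clm_apply_eq_sub hf
  have h1 : ContDiff ℝ (⊤ : ℕ∞) fun z => G z 1 := hG.clm_apply contDiff_const
  have hI : ContDiff ℝ (⊤ : ℕ∞) fun z => G z I := hG.clm_apply contDiff_const
  refine ⟨fun z => (G z 1 - I * G z I) / 2, fun z => (G z 1 + I * G z I) / 2,
    (h1.sub (contDiff_const.mul hI)).div_const 2, (h1.add (contDiff_const.mul hI)).div_const 2,
    fun z => ?_⟩
  have hz : G z z = z.re * G z 1 + z.im * G z I := by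
    have hz : z.re • (1 : ℂ) + z.im • I = z := by simp [Complex.re_add_im]
    calc G z z = G z (z.re • (1 : ℂ) + z.im • I) := by rw [hz]
      _ = _ := by rw [map_add, map_smul, map_smul, Complex.real_smul, Complex.real_smul]
  have := h z
  rw [h0, sub_zero, hz] at this
  rw [this, Complex.re_eq_add_conj, Complex.im_eq_sub_conj]
  field_simp
  ring_nf
  simp only [I_sq]
  ring

theorem contDiff_conj : ContDiff ℝ (⊤ : ℕ∞) (fun z : ℂ => conj z) :=
  conjCLE.contDiff

theorem continuous_conj_pow_div_pow {N m : ℕ} (h : m + 1 ≤ N) :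
    Continuous fun z : ℂ => conj z ^ N / z ^ m := by
  refine continuous_iff_continuousAt.2 fun z => ?_
  rcases eq_or_ne z 0 with rfl | hz
  · have hN : N ≠ 0 := by omega
    rw [ContinuousAt]
    simp only [map_zero, zero_pow hN, zero_div]
    refine squeeze_zero_norm (a := fun z : ℂ => ‖z‖ ^ (N - m)) (fun z => ?_) ?_
    · rcases eq_or_ne z 0 with rfl | hz
      · simp [hN]
      · simp [pow_sub₀ ‖z‖ (norm_ne_zero_iff.2 hz) (show m ≤ N by omega), div_eq_mul_inv]
    · have : Continuous fun z : ℂ => ‖z‖ ^ (N - m) := by fun_prop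
      simpa [show N - m ≠ 0 by omega] using this.tendsto 0
  · exact (continuous_conj.pow N).continuousAt.div (by fun_prop) (pow_ne_zero m hz)

theorem hasFDerivAt_conj_pow_div_pow {N m : ℕ} (h : m + 2 ≤ N) (z : ℂ) :
    HasFDerivAt (fun z : ℂ => conj z ^ N / z ^ m)
      ((N * (conj z ^ (N - 1) / z ^ m)) • (conjCLE : ℂ →L[ℝ] ℂ) -
        (m * (conj z ^ N / z ^ (m + 1))) • ContinuousLinearMap.id ℝ ℂ) z := by
  rcases eq_or_ne z 0 with rfl | hz
  · have : (fun z : ℂ => conj z ^ N / z ^ m) =O[nhds 0] fun z => ‖z - 0‖ ^ (N - m) := by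
      refine Asymptotics.IsBigO.of_norm_le fun z => ?_
      rcases eq_or_ne z 0 with rfl | hz
      · simp [show N ≠ 0 by omega]
      · simp [pow_sub₀ ‖z‖ (norm_ne_zero_iff.2 hz) (show m ≤ N by omega), div_eq_mul_inv]
    refine (this.hasFDerivAt (𝕜 := ℝ) (by omega : 1 < N - m)).congr_fderiv ?_
    ext v
    simp [show N ≠ 0 by omega, show N - 1 ≠ 0 by omega]
  · have h1 : HasFDerivAt (fun z : ℂ => conj z) (conjCLE : ℂ →L[ℝ] ℂ) z := conjCLE.hasFDerivAt
    have h2 := ((hasDerivAt_pow m z).fun_inv (pow_ne_zero m hz)).complexToReal_fderiv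
    simp only [div_eq_mul_inv (conj _ ^ N)]
    refine ((h1.pow N).mul h2).congr_fderiv ?_
    ext v
    rcases m with _ | m
    · simp
    · simp
      field_simp
      ring

/-- `conj z ^ N / z ^ m`, with value `0` at `0`, is `C^k` when `N ≥ m + k + 1`. -/
theorem contDiff_conj_pow_div_pow (k : ℕ) :
    ∀ {N m : ℕ}, m + k + 1 ≤ N → ContDiff ℝ k fun z : ℂ => conj z ^ N / z ^ m := by
  induction k with
  | zero => exact fun h => contDiff_zero.2 (continuous_conj_pow_div_pow (by omega))
  | succ k ih =>
    intro N m h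
    have hd := fun z => hasFDerivAt_conj_pow_div_pow (N := N) (m := m) (by omega) z
    have : ContDiff ℝ ((k : WithTop ℕ∞) + 1) fun z : ℂ => conj z ^ N / z ^ m := by
      refine contDiff_succ_iff_fderiv.2 ⟨fun z => (hd z).differentiableAt, by simp, ?_⟩
      rw [funext fun z => (hd z).fderiv]
      exact ((contDiff_const.mul (ih (by omega))).smul contDiff_const).sub
        ((contDiff_const.mul (ih (by omega))).smul contDiff_const)
    exact_mod_cast this

theorem contDiff_Dbar {f : ℂ → ℂ} (hf : ContDiff ℝ (⊤ : ℕ∞) f) :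
    ContDiff ℝ (⊤ : ℕ∞) (Dbar f) := by
  have hf1 : ContDiff ℝ (⊤ : ℕ∞) (fderiv ℝ f) := hf.fderiv_right (by simp)
  exact contDiff_const.mul ((hf1.clm_apply contDiff_const).add
    (contDiff_const.mul (hf1.clm_apply contDiff_const)))

theorem Dbar_add {f g : ℂ → ℂ} (hf : ContDiff ℝ (⊤ : ℕ∞) f) (hg : ContDiff ℝ (⊤ : ℕ∞) g) :
    Dbar (fun z => f z + g z) = fun z => Dbar f z + Dbar g z := by
  funext z
  simp only [Dbar, fderiv_fun_add (hf.differentiable (by simp) z) (hg.differentiable (by simp) z),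
    add_apply]
  ring

theorem Dbar_mul {f g : ℂ → ℂ} (hf : ContDiff ℝ (⊤ : ℕ∞) f) (hg : ContDiff ℝ (⊤ : ℕ∞) g) :
    Dbar (fun z => f z * g z) = fun z => Dbar f z * g z + f z * Dbar g z := by
  funext z
  simp only [Dbar, fderiv_fun_mul (hf.differentiable (by simp) z) (hg.differentiable (by simp) z),
    add_apply, smul_apply, smul_eq_mul]
  ring

theorem Dbar_id : Dbar (fun z => z) = fun _ => 0 := by
  funext z
  simp [Dbar]

theorem Dbar_const (c : ℂ) : Dbar (fun _ => c) = fun _ => 0 := by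
  funext z
  simp [Dbar]

theorem Dbar_conj : Dbar (fun z => conj z) = fun _ => 2 / I := by
  funext z
  have : fderiv ℝ (fun z : ℂ => conj z) z = (conjCLE : ℂ →L[ℝ] ℂ) := conjCLE.fderiv
  simp only [Dbar, this]
  simp
  ring

theorem Dbar_comp_add_right (f : ℂ → ℂ) (a : ℂ) :
    Dbar (fun z => f (z + a)) = fun z => Dbar f (z + a) := by
  funext z
  simp only [Dbar, fderiv_comp_add_right]

/-- The iterates `Dbar^j f`, `j ≤ n`, all vanish at the origin. -/
def DbarFlat : ℕ → (ℂ → ℂ) → Prop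
  | 0, f => f 0 = 0
  | n + 1, f => f 0 = 0 ∧ DbarFlat n (Dbar f)

namespace DbarFlat

theorem apply_zero {n : ℕ} {f : ℂ → ℂ} (h : DbarFlat n f) : f 0 = 0 := by
  cases n with
  | zero => exact h
  | succ n => exact h.1

theorem of_succ {n : ℕ} : ∀ {f : ℂ → ℂ}, DbarFlat (n + 1) f → DbarFlat n f := by
  induction n with
  | zero => exact fun h => h.1
  | succ n ih => exact fun h => ⟨h.1, ih h.2⟩

theorem add {n : ℕ} : ∀ {f g : ℂ → ℂ}, ContDiff ℝ (⊤ : ℕ∞) f → ContDiff ℝ (⊤ : ℕ∞) g →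
    DbarFlat n f → DbarFlat n g → DbarFlat n fun z => f z + g z := by
  induction n with
  | zero =>
    intro f g _ _ h h'
    simp only [DbarFlat] at *
    simp [h, h']
  | succ n ih =>
    intro f g hf hg h h'
    refine ⟨by simp [h.1, h'.1], ?_⟩
    rw [Dbar_add hf hg]
    exact ih (contDiff_Dbar hf) (contDiff_Dbar hg) h.2 h'.2

theorem mul_left {n : ℕ} : ∀ {a f : ℂ → ℂ}, ContDiff ℝ (⊤ : ℕ∞) a → ContDiff ℝ (⊤ : ℕ∞) f →
    DbarFlat n f → DbarFlat n fun z => a z * f z := by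
  induction n with
  | zero =>
    intro a f _ _ h
    simp only [DbarFlat] at *
    simp [h]
  | succ n ih =>
    intro a f ha hf h
    refine ⟨by simp [h.1], ?_⟩
    rw [Dbar_mul ha hf]
    exact add ((contDiff_Dbar ha).mul hf) (ha.mul (contDiff_Dbar hf))
      (ih (contDiff_Dbar ha) hf h.of_succ) (ih ha (contDiff_Dbar hf) h.2)

theorem id_mul (n : ℕ) : ∀ {a : ℂ → ℂ}, ContDiff ℝ (⊤ : ℕ∞) a → DbarFlat n fun z => z * a z := by
  induction n with
  | zero => intro a _; simp [DbarFlat]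
  | succ n ih =>
    intro a ha
    refine ⟨by simp, ?_⟩
    rw [Dbar_mul (f := fun z => z) contDiff_id ha]
    simpa [Dbar_id] using ih (contDiff_Dbar ha)

theorem of_const_mul_add_conj_mul {n : ℕ} : ∀ (c : ℕ) {b : ℂ → ℂ}, ContDiff ℝ (⊤ : ℕ∞) b →
    DbarFlat n (fun z => (c + 1) * (2 / I) * b z + conj z * Dbar b z) → DbarFlat n b := by
  have key : ∀ (c : ℕ) (b : ℂ → ℂ),
      ((c : ℂ) + 1) * (2 / I) * b 0 + conj 0 * Dbar b 0 = 0 → b 0 = 0 := by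
    intro c b h
    have hc : (c : ℂ) + 1 ≠ 0 := Nat.cast_add_one_ne_zero c
    simpa [hc] using h
  induction n with
  | zero => exact fun c b _ h => key c b h
  | succ n ih =>
    intro c b hb h
    refine ⟨key c b h.1, ih (c + 1) (contDiff_Dbar hb) ?_⟩
    have h2 := h.2
    rw [Dbar_add (contDiff_const.mul hb) (contDiff_conj.mul (contDiff_Dbar hb)),
      Dbar_mul contDiff_const hb, Dbar_mul contDiff_conj (contDiff_Dbar hb), Dbar_conj,
      Dbar_const] at h2
    convert h2 using 2 with z
    push_cast
    ring

theorem of_conj_mul {n : ℕ} {b : ℂ → ℂ} (hb : ContDiff ℝ (⊤ : ℕ∞) b)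
    (h : DbarFlat (n + 1) fun z => conj z * b z) : DbarFlat n b := by
  refine of_const_mul_add_conj_mul 0 hb ?_
  have h2 := h.2
  rw [Dbar_mul contDiff_conj hb, Dbar_conj] at h2
  simpa using h2

theorem exists_eq_mul_add_conj_pow_mul {n : ℕ} : ∀ {f : ℂ → ℂ}, ContDiff ℝ (⊤ : ℕ∞) f →
    DbarFlat n f → ∃ A B : ℂ → ℂ, ContDiff ℝ (⊤ : ℕ∞) A ∧ ContDiff ℝ (⊤ : ℕ∞) B ∧
      ∀ z, f z = z * A z + conj z ^ (n + 1) * B z := by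
  induction n with
  | zero =>
    intro f hf h
    simpa using exists_eq_mul_add_conj_mul hf h.apply_zero
  | succ n ih =>
    intro f hf h
    obtain ⟨A, b, hA, hb, hAb⟩ := exists_eq_mul_add_conj_mul hf h.apply_zero
    have hconj : DbarFlat (n + 1) fun z => conj z * b z := by
      have := add hf (contDiff_id.mul hA.neg) h (id_mul (n + 1) hA.neg)
      convert this using 2 with z
      simp [hAb z]
    obtain ⟨A', B, hA', hB, hAB⟩ := ih hb (of_conj_mul hb hconj)
    refine ⟨fun z => A z + conj z * A' z, B, hA.add (contDiff_conj.mul hA'), hB, fun z => ?_⟩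
    rw [hAb z, hAB z]
    ring

/-- A smooth function all of whose iterated `Dbar` derivatives vanish at `0` is smoothly
divisible by `z`. -/
theorem exists_contDiff_eq_mul {f : ℂ → ℂ} (hf : ContDiff ℝ (⊤ : ℕ∞) f)
    (h : ∀ n, DbarFlat n f) : ∃ w : ℂ → ℂ, ContDiff ℝ (⊤ : ℕ∞) w ∧ ∀ z, f z = z * w z := by
  have key : ∀ k : ℕ, ∃ w : ℂ → ℂ, ContDiff ℝ k w ∧ ∀ z, f z = z * w z := by
    intro k
    obtain ⟨A, B, hA, hB, hAB⟩ := exists_eq_mul_add_conj_pow_mul hf (h (k + 1))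
    refine ⟨fun z => A z + conj z ^ (k + 1 + 1) / z ^ 1 * B z,
      (contDiff_infty.1 hA k).add
        ((contDiff_conj_pow_div_pow k (by omega)).mul (contDiff_infty.1 hB k)), fun z => ?_⟩
    rw [hAB z]
    rcases eq_or_ne z 0 with rfl | hz
    · simp
    · field_simp
  choose w hw hfw using key
  refine ⟨w 0, contDiff_infty.2 fun k => ?_, hfw 0⟩
  have : w 0 = w k := by
    refine Continuous.ext_on (dense_compl_singleton (0 : ℂ)) (hw 0).continuous
      (hw k).continuous fun z hz => ?_
    exact mul_left_cancel₀ hz ((hfw 0 z).symm.trans (hfw k z))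
  exact this ▸ hw k

end DbarFlat

/-- A smooth solution of a first-order system `Dbar f = a g`, `Dbar g = b f` which vanishes at
a point `p` is smoothly divisible by `z - p`. -/
theorem exists_contDiff_eq_sub_smul {u : ℂ → ℂ × ℂ} {a b : ℂ → ℂ}
    (hu : ContDiff ℝ (⊤ : ℕ∞) u) (ha : ContDiff ℝ (⊤ : ℕ∞) a) (hb : ContDiff ℝ (⊤ : ℕ∞) b)
    (h1 : ∀ z, Dbar (fun w => (u w).1) z = a z * (u z).2)
    (h2 : ∀ z, Dbar (fun w => (u w).2) z = b z * (u z).1) {p : ℂ} (hp : u p = 0) :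
    ∃ w : ℂ → ℂ × ℂ, ContDiff ℝ (⊤ : ℕ∞) w ∧ ∀ z, u z = (z - p) • w z := by
  have hs : ContDiff ℝ (⊤ : ℕ∞) fun z : ℂ => z + p := contDiff_id.add contDiff_const
  have hf : ContDiff ℝ (⊤ : ℕ∞) fun z => (u (z + p)).1 := (hu.comp hs).fst
  have hg : ContDiff ℝ (⊤ : ℕ∞) fun z => (u (z + p)).2 := (hu.comp hs).snd
  have flat : ∀ n, DbarFlat n (fun z => (u (z + p)).1) ∧ DbarFlat n (fun z => (u (z + p)).2) := by
    intro n
    induction n with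
    | zero => simp [DbarFlat, hp]
    | succ n ih =>
      refine ⟨⟨by simp [hp], ?_⟩, ⟨by simp [hp], ?_⟩⟩
      · rw [Dbar_comp_add_right (fun z => (u z).1)]
        simp only [h1]
        exact DbarFlat.mul_left (ha.comp hs) hg ih.2
      · rw [Dbar_comp_add_right (fun z => (u z).2)]
        simp only [h2]
        exact DbarFlat.mul_left (hb.comp hs) hf ih.1
  obtain ⟨w₁, hw₁, e₁⟩ := DbarFlat.exists_contDiff_eq_mul hf fun n => (flat n).1
  obtain ⟨w₂, hw₂, e₂⟩ := DbarFlat.exists_contDiff_eq_mul hg fun n => (flat n).2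
  have hs' : ContDiff ℝ (⊤ : ℕ∞) fun z : ℂ => z - p := contDiff_id.sub contDiff_const
  refine ⟨fun z => (w₁ (z - p), w₂ (z - p)), (hw₁.comp hs').prodMk (hw₂.comp hs'), fun z => ?_⟩
  have e₁' := e₁ (z - p)
  have e₂' := e₂ (z - p)
  rw [sub_add_cancel] at e₁' e₂'
  exact Prod.ext (by simpa using e₁') (by simpa using e₂')

theorem ω_eq : ω = -1 / 2 + Real.sqrt 3 / 2 * I := by
  have h : (2 * Real.pi * I / 3 : ℂ) = ((Real.pi - Real.pi / 3 : ℝ) : ℂ) * I := by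
    push_cast
    ring
  rw [ω, h, Complex.exp_mul_I, ← Complex.ofReal_cos, ← Complex.ofReal_sin, Real.cos_pi_sub,
    Real.sin_pi_sub, Real.cos_pi_div_three, Real.sin_pi_div_three]
  push_cast
  ring

theorem ω_mul_zS : ω * zS = zS + (-1 - ω) := by
  have h3 : ((Real.sqrt 3 : ℝ) : ℂ) ^ 2 = 3 := by
    rw [← Complex.ofReal_pow, Real.sq_sqrt (by norm_num)]
    norm_num
  have h0 : ((Real.sqrt 3 : ℝ) : ℂ) ≠ 0 := by simp
  rw [zS, ω_eq]
  field_simp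
  ring_nf
  simp only [I_sq, h3]
  ring

theorem pair_neg_one_sub_ω : pair (-1 - ω) K = -(2 * Real.pi / 3) := by
  have hK : K = ((4 * Real.pi / 3 : ℝ) : ℂ) := by simp [K]
  rw [pair, hK, Complex.conj_ofReal, Complex.re_mul_ofReal, ω_eq]
  simp
  ring

theorem ω_ne_one : ω ≠ 1 := by
  intro h
  have := congrArg Complex.re h
  rw [ω_eq] at this
  norm_num at this

theorem eq_zero_of_eq_mul_self {c x : ℂ} (hc : c ≠ 1) (h : x = c * x) : x = 0 := by
  by_contra hx
  exact hc (mul_right_cancel₀ hx (by rw [← h, one_mul]))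

/-- **zeros of flat-band eigenfunctions in the trivial representation.**
Every `u ∈ Ker₀(α)` vanishes at `±z_S` and factors smoothly through `z ∓ z_S`. -/
theorem zeros_in_trivial_representation (U : ℂ → ℂ) (hU : IsTunnelling U) (α : ℂ)
    (u : ℂ → ℂ × ℂ) (hu : u ∈ kerPSet U (fun z => U (-z)) α 0) :
    u zS = 0 ∧ u (-zS) = 0 ∧
      (∃ w₁ : ℂ → ℂ × ℂ, ContDiff ℝ (⊤ : ℕ∞) w₁ ∧ ∀ z : ℂ, u z = (z - zS) • w₁ z) ∧
      (∃ w₂ : ℂ → ℂ × ℂ, ContDiff ℝ (⊤ : ℕ∞) w₂ ∧ ∀ z : ℂ, u z = (z + zS) • w₂ z) := by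
  obtain ⟨⟨hsm, h1, h2, hγ1, hγ2⟩, hrot⟩ := hu
  have hω : ∀ z, u (ω * z) = u z := fun z => by simpa using hrot z
  have hexp : Complex.exp (I * (2 * Real.pi / 3 : ℝ)) = ω := by
    rw [ω]
    congr 1
    push_cast
    ring
  have hexp' : Complex.exp (-I * (2 * Real.pi / 3 : ℝ)) ≠ 1 := by
    rw [neg_mul, Complex.exp_neg, hexp, Ne, inv_eq_one]
    exact ω_ne_one
  have hmem : -1 - ω ∈ Λ := ⟨-1, -1, by push_cast; ring⟩
  have hmem' : 1 + ω ∈ Λ := ⟨1, 1, by push_cast; ring⟩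
  have hpair' : pair (1 + ω) K = 2 * Real.pi / 3 := by
    have h : pair (1 + ω) K = -pair (-1 - ω) K := by
      rw [pair, pair, ← Complex.neg_re]
      congr 1
      ring
    rw [h, pair_neg_one_sub_ω, neg_neg]
  have hS : u zS = 0 := by
    have h := hω zS
    rw [ω_mul_zS] at h
    have e1 := hγ1 _ hmem zS
    have e2 := hγ2 _ hmem zS
    rw [h, pair_neg_one_sub_ω, Complex.ofReal_neg, mul_neg] at e1 e2
    rw [neg_mul, neg_neg, hexp] at e1
    rw [← neg_mul] at e2
    exact Prod.ext (eq_zero_of_eq_mul_self ω_ne_one e1) (eq_zero_of_eq_mul_self hexp' e2)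
  have hS' : u (-zS) = 0 := by
    have h := hω (-zS)
    rw [show ω * -zS = -zS + (1 + ω) by linear_combination -ω_mul_zS] at h
    have e1 := hγ1 _ hmem' (-zS)
    have e2 := hγ2 _ hmem' (-zS)
    rw [h, hpair'] at e1 e2
    rw [hexp] at e2
    exact Prod.ext (eq_zero_of_eq_mul_self hexp' e1) (eq_zero_of_eq_mul_self ω_ne_one e2)
  have ha : ContDiff ℝ (⊤ : ℕ∞) fun z => -(α * U z) := (contDiff_const.mul hU.1).neg
  have hb : ContDiff ℝ (⊤ : ℕ∞) fun z => -(α * U (-z)) :=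
    (contDiff_const.mul (hU.1.comp contDiff_neg)).neg
  have h1' : ∀ z, Dbar (fun w => (u w).1) z = -(α * U z) * (u z).2 := fun z => by
    linear_combination h1 z
  have h2' : ∀ z, Dbar (fun w => (u w).2) z = -(α * U (-z)) * (u z).1 := fun z => by
    linear_combination h2 z
  refine ⟨hS, hS', exists_contDiff_eq_sub_smul hsm ha hb h1' h2' hS, ?_⟩
  simpa using exists_contDiff_eq_sub_smul hsm ha hb h1' h2' hS'

end TBG
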